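/- arXiv:1212.5686 — 2 statements merged into one kernel-verified Lean document; each statement's English description precedes it below -/
import Mathlib

section
/- Let ρ be a zero proximate order. Then V(r) = C(r)·V₁(r) for all r > 0, where V₁(r) = r^{ρ₁(r)} for some zero proximate order ρ₁ that is infinitely differentiable on (0,∞)\{1} and satisfies ρ₁(1/r) = −ρ₁(r), and where C is a continuous positive function on (0,∞) with C(r) → 1 as r → ∞ and as r → 0+. -/
open MeasureTheory Filter Topology Set
open scoped ENNReal

noncomputable section

/-- `V ρ r = r ^ ρ(r)`. -/
def V (ρ : ℝ → ℝ) (r : ℝ) : ℝ := r ^ ρ r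

/-- A proximate order (in the sense of Valiron) with limit `l` at infinity:
`ρ` is locally absolutely continuous on `(0,∞)`, `ρ(r) → l`, and
`r · log r · ρ'(r) → 0` as `r → ∞`. -/
structure IsProximateOrder (ρ : ℝ → ℝ) (l : ℝ) : Prop where
  locAC : ∀ a : ℝ, 0 < a → ∀ b : ℝ, a ≤ b →
    MeasureTheory.IntegrableOn (deriv ρ) (Set.Icc a b) ∧
      ∀ x ∈ Set.Icc a b, ρ x = ρ a + ∫ t in a..x, deriv ρ t
  tendsto_lim : Filter.Tendsto ρ Filter.atTop (nhds l)
  tendsto_deriv : Filter.Tendsto (fun r => r * Real.log r * deriv ρ r) Filter.atTop (nhds 0)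

/-- A zero proximate order: a proximate order with limit `0`, satisfying
`ρ(1/r) = -ρ(r)`, continuously differentiable on `(0,∞) \ {1}`, and such that
`V(r) = r ^ ρ(r)` extends continuously to `r = 1` with value `V(1) = 1`. -/
structure IsZeroProximateOrder (ρ : ℝ → ℝ) : Prop where
  proximate : IsProximateOrder ρ 0
  symm : ∀ r : ℝ, 0 < r → ρ r⁻¹ = -ρ r
  diffAway : ∀ x ∈ Set.Ioi (0:ℝ) \ {1}, DifferentiableAt ℝ ρ x
  derivCont : ContinuousOn (deriv ρ) (Set.Ioi (0:ℝ) \ {1})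
  V_one : Filter.Tendsto (V ρ) (nhdsWithin 1 (Set.Ioi (0:ℝ) \ {1})) (nhds 1)

lemma mollify (f : ℝ → ℝ) (hf : Continuous f) (hodd : ∀ x, f (-x) = -f x)
    (hL : ∀ ε > 0, ∃ X : ℝ, 0 < X ∧ ∀ x ≥ X, ∀ y ∈ Set.Icc (x-2) (x+2), ∀ z ∈ Set.Icc (x-2) (x+2),
      x * |f y - f z| ≤ ε * |y - z|) :
    ∃ g : ℝ → ℝ, ContDiff ℝ (⊤ : ℕ∞) g ∧ (∀ x, g (-x) = -g x) ∧
      Tendsto (fun x => x * (f x - g x)) atTop (𝓝 0) ∧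
      Tendsto (fun x => x * deriv g x) atTop (𝓝 0) := by
  let φ : ContDiffBump (0:ℝ) := ⟨1/2, 1, by norm_num, by norm_num⟩
  let ψ : ℝ → ℝ := φ.normed volume
  have hψc : Continuous ψ := φ.continuous_normed
  have hψs : HasCompactSupport ψ := φ.hasCompactSupport_normed
  have hψi : ∫ t, ψ t = 1 := φ.integral_normed
  have hψint : Integrable ψ := φ.integrable_normed
  have hψ0 : ∀ t, 0 ≤ ψ t := fun t => φ.nonneg_normed t
  have hψe : ∀ t, ψ (-t) = ψ t := fun t => φ.normed_neg t
  have hψz : ∀ t, 1 ≤ |t| → ψ t = 0 := by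
    intro t ht
    have : t ∉ Function.support ψ := by
      rw [show Function.support ψ = Metric.ball 0 φ.rOut from φ.support_normed_eq]
      simpa [φ] using ht
    simpa using this
  have hI : ∀ x, Integrable (fun t => ψ t * f (x - t)) := fun x =>
    (by fun_prop : Continuous (fun t => ψ t * f (x - t))).integrable_of_hasCompactSupport
      hψs.mul_right
  let g : ℝ → ℝ := fun x => ∫ t, ψ t * f (x - t)
  have key : ∀ (h : ℝ → ℝ) (M : ℝ), (∀ t, |t| < 1 → |h t| ≤ M) →
      |∫ t, ψ t * h t| ≤ M := by
    intro h M hM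
    have h1 : ‖∫ t, ψ t * h t‖ ≤ ∫ t, ψ t * M := by
      apply norm_integral_le_of_norm_le (hψint.mul_const M)
      filter_upwards with t
      rw [norm_mul, Real.norm_of_nonneg (hψ0 t), Real.norm_eq_abs]
      by_cases ht : |t| < 1
      · exact mul_le_mul_of_nonneg_left (hM t ht) (hψ0 t)
      · simp [hψz t (not_lt.mp ht)]
    rw [integral_mul_const, hψi, one_mul] at h1
    exact h1
  have hg : ContDiff ℝ (⊤ : ℕ∞) g := by
    have := hψs.contDiff_convolution_left (n := (⊤ : ℕ∞)) (ContinuousLinearMap.lsmul ℝ ℝ)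
      (μ := volume) (f := ψ) (g := f) φ.contDiff_normed hf.locallyIntegrable
    exact this
  have hsub : ∀ y z, g y - g z = ∫ t, ψ t * (f (y - t) - f (z - t)) := by
    intro y z
    simp only [g]
    rw [← integral_sub (hI y) (hI z)]
    congr 1; ext t; ring
  refine ⟨g, hg, ?_, ?_, ?_⟩
  · intro x
    simp only [g]
    rw [← integral_neg, ← integral_neg_eq_self]
    congr 1; ext t
    rw [hψe, show -x - -t = -(x - t) by ring, hodd]; ring
  · rw [Metric.tendsto_atTop]
    intro ε hε
    obtain ⟨X, hX0, hX⟩ := hL (ε/2) (by positivity)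
    refine ⟨X, fun x hx => ?_⟩
    have hx0 : 0 < x := hX0.trans_le hx
    have : f x - g x = ∫ t, ψ t * (f x - f (x - t)) := by
      simp only [g, mul_sub]
      rw [integral_sub (hψint.mul_const _) (hI x), integral_mul_const, hψi, one_mul]
    have h2 : |f x - g x| ≤ ε / 2 / x := by
      rw [this]
      apply key
      intro t ht
      have ht' := abs_lt.mp ht
      have := hX x hx x ⟨by linarith, by linarith⟩ (x - t) ⟨by linarith, by linarith⟩
      rw [le_div_iff₀ hx0, mul_comm]
      rw [show x - (x - t) = t by ring] at this
      nlinarith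
    rw [le_div_iff₀ hx0] at h2
    rw [Real.dist_eq, sub_zero, abs_mul, abs_of_pos hx0]
    linarith
  · rw [Metric.tendsto_atTop]
    intro ε hε
    obtain ⟨X, hX0, hX⟩ := hL (ε/2) (by positivity)
    refine ⟨X, fun x hx => ?_⟩
    have hx0 : 0 < x := hX0.trans_le hx
    have h2 : ‖deriv g x‖ ≤ ε / 2 / x := by
      apply norm_deriv_le_of_lip' (by positivity)
      filter_upwards [Metric.ball_mem_nhds x one_pos] with y hy
      rw [Metric.mem_ball, Real.dist_eq, abs_lt] at hy
      rw [hsub, Real.norm_eq_abs, Real.norm_eq_abs]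
      apply key
      intro t ht
      have ht' := abs_lt.mp ht
      have := hX x hx (y - t) ⟨by linarith, by linarith⟩ (x - t) ⟨by linarith, by linarith⟩
      rw [show y - t - (x - t) = y - x by ring] at this
      rw [div_mul_eq_mul_div, le_div_iff₀ hx0, mul_comm]
      exact this
    rw [le_div_iff₀ hx0] at h2
    rw [Real.dist_eq, sub_zero, abs_mul, abs_of_pos hx0]
    rw [Real.norm_eq_abs] at h2
    linarith

lemma zpo_cont (ρ : ℝ → ℝ) (h : IsZeroProximateOrder ρ) : ContinuousOn ρ (Set.Ioi 0) := by
  intro x hx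
  apply ContinuousAt.continuousWithinAt
  have hx : 0 < x := hx
  obtain ⟨hi, he⟩ := h.proximate.locAC (x/2) (by positivity) (2*x) (by linarith)
  have h1 : ContinuousOn ρ (Set.Icc (x/2) (2*x)) := by
    refine ContinuousOn.congr ?_ he
    apply continuousOn_const.add
    have := intervalIntegral.continuousOn_primitive_interval (μ := volume) (f := deriv ρ)
      (a := x/2) (b := 2*x) (by rwa [Set.uIcc_of_le (by linarith)])
    rwa [Set.uIcc_of_le (by linarith)] at this
  exact h1.continuousAt (Icc_mem_nhds (by linarith) (by linarith))

lemma zpo_lip (ρ : ℝ → ℝ) (h : IsZeroProximateOrder ρ) :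
    ∀ ε > 0, ∃ X : ℝ, 0 < X ∧ ∀ x ≥ X, ∀ y ∈ Set.Icc (x-2) (x+2), ∀ z ∈ Set.Icc (x-2) (x+2),
      x * |ρ (Real.exp y) - ρ (Real.exp z)| ≤ ε * |y - z| := by
  intro ε hε
  have h1 := h.proximate.tendsto_deriv.comp Real.tendsto_exp_atTop
  rw [Metric.tendsto_atTop] at h1
  obtain ⟨X, hX⟩ := h1 (ε/2) (by positivity)
  refine ⟨max 4 (X+2), by positivity, fun x hx y hy z hz => ?_⟩
  have hx4 : 4 ≤ x := (le_max_left _ _).trans hx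
  have hxX : X + 2 ≤ x := (le_max_right _ _).trans hx
  have hd : ∀ w ∈ Set.Icc (x-2) (x+2),
      HasDerivWithinAt (fun u => ρ (Real.exp u)) (deriv ρ (Real.exp w) * Real.exp w)
        (Set.Icc (x-2) (x+2)) w := by
    intro w hw
    have hw1 : Real.exp w ≠ 1 := by
      have : w ≠ 0 := by linarith [hw.1]
      simpa using this
    have := (h.diffAway (Real.exp w) ⟨Real.exp_pos w, hw1⟩).hasDerivAt
    exact (this.comp w (Real.hasDerivAt_exp w)).hasDerivWithinAt
  have hb : ∀ w ∈ Set.Icc (x-2) (x+2), ‖deriv ρ (Real.exp w) * Real.exp w‖ ≤ ε / x := by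
    intro w hw
    have := hX w (by linarith [hw.1])
    simp only [Function.comp, Real.log_exp, dist_zero_right, Real.norm_eq_abs] at this
    have hw0 : 0 < w := by linarith [hw.1]
    rw [show Real.exp w * w * deriv ρ (Real.exp w) = w * (deriv ρ (Real.exp w) * Real.exp w) by ring,
      abs_mul, abs_of_pos hw0] at this
    rw [le_div_iff₀ (by linarith), Real.norm_eq_abs]
    have h3 : x ≤ 2 * w := by linarith [hw.1]
    nlinarith [abs_nonneg (deriv ρ (Real.exp w) * Real.exp w)]
  have := (convex_Icc (x-2) (x+2)).norm_image_sub_le_of_norm_hasDerivWithin_le hd hb hz hy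
  rw [Real.norm_eq_abs, Real.norm_eq_abs, div_mul_eq_mul_div, le_div_iff₀ (by linarith)] at this
  linarith

/-- Theorem 2.4: every zero proximate order `ρ` factors as
`V(r) = C(r) · V₁(r)` with `V₁(r) = r^{ρ₁(r)}` for a zero proximate order `ρ₁`
infinitely differentiable on `(0,∞) \ {1}` with `ρ₁(1/r) = -ρ₁(r)`, and a
continuous positive function `C` on `(0,∞)` with `C(r) → 1` as `r → ∞` and
as `r → 0⁺`. -/
theorem statement0 (ρ : ℝ → ℝ) (h : IsZeroProximateOrder ρ) :
    ∃ ρ₁ C : ℝ → ℝ,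
      IsZeroProximateOrder ρ₁ ∧
      ContDiffOn ℝ (⊤ : ℕ∞) ρ₁ (Set.Ioi (0:ℝ) \ {1}) ∧
      (∀ r : ℝ, 0 < r → ρ₁ r⁻¹ = -ρ₁ r) ∧
      ContinuousOn C (Set.Ioi (0:ℝ)) ∧
      (∀ r : ℝ, 0 < r → 0 < C r) ∧
      Filter.Tendsto C Filter.atTop (nhds 1) ∧
      Filter.Tendsto C (nhdsWithin 0 (Set.Ioi (0:ℝ))) (nhds 1) ∧
      (∀ r : ℝ, 0 < r → V ρ r = C r * V ρ₁ r) := by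
  have hρc := zpo_cont ρ h
  obtain ⟨g, hg, hgo, hg1, hg2⟩ := mollify (fun x => ρ (Real.exp x))
    (hρc.comp_continuous Real.continuous_exp (fun x => Real.exp_pos x))
    (fun x => by rw [Real.exp_neg]; exact h.symm _ (Real.exp_pos x)) (zpo_lip ρ h)
  have hg0 : g 0 = 0 := by have := hgo 0; simp at this; linarith
  let ρ₁ : ℝ → ℝ := fun r => g (Real.log r)
  have hsm : ∀ r ≠ 0, ContDiffAt ℝ (⊤ : ℕ∞) ρ₁ r := fun r hr =>
    hg.contDiffAt.comp r (Real.contDiffAt_log.mpr hr)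
  have hdiff : ∀ r ≠ 0, DifferentiableAt ℝ ρ₁ r := fun r hr =>
    (hsm r hr).differentiableAt (by simp)
  have hder : ∀ r ≠ 0, deriv ρ₁ r = deriv g (Real.log r) * r⁻¹ := fun r hr =>
    (((hg.differentiable (by simp)).differentiableAt.hasDerivAt).comp r
      (Real.hasDerivAt_log hr)).deriv
  have hgd : Continuous (deriv g) := hg.continuous_deriv (by exact_mod_cast le_top)
  have hdc : ContinuousOn (deriv ρ₁) (Set.Ioi 0) := by
    apply ContinuousOn.congr (f := fun r => deriv g (Real.log r) * r⁻¹)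
    · apply ContinuousOn.mul
      · exact hgd.comp_continuousOn (Real.continuousOn_log.mono (fun x hx => ne_of_gt hx))
      · exact continuousOn_inv₀.mono (fun x hx => ne_of_gt hx)
    · intro r hr
      exact hder r (ne_of_gt hr)
  have hsymm : ∀ r : ℝ, 0 < r → ρ₁ r⁻¹ = -ρ₁ r := by
    intro r hr
    simp only [ρ₁, Real.log_inv, hgo]
  have hdl : Tendsto (fun r => Real.log r * (ρ r - ρ₁ r)) atTop (𝓝 0) := by
    refine (hg1.comp Real.tendsto_log_atTop).congr' ?_
    filter_upwards [eventually_gt_atTop 0] with r hr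
    simp [ρ₁, Real.exp_log hr]
  have hC1 : Tendsto (fun r => Real.exp (Real.log r * (ρ r - ρ₁ r))) atTop (𝓝 1) := by
    have := (Real.continuous_exp.tendsto 0).comp hdl
    rwa [Real.exp_zero] at this
  have hlim : Tendsto ρ₁ atTop (𝓝 0) := by
    have h1 : Tendsto (fun r => (Real.log r * (ρ r - ρ₁ r)) * (Real.log r)⁻¹) atTop (𝓝 (0*0)) :=
      hdl.mul (tendsto_inv_atTop_zero.comp Real.tendsto_log_atTop)
    have h2 := h.proximate.tendsto_lim.sub h1
    rw [mul_zero, sub_zero] at h2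
    refine h2.congr' ?_
    filter_upwards [eventually_gt_atTop 1] with r hr
    have := (Real.log_pos hr).ne'
    field_simp
    ring
  have hz : IsZeroProximateOrder ρ₁ := by
    refine ⟨⟨?_, hlim, ?_⟩, hsymm, ?_, ?_, ?_⟩
    · intro a ha b hab
      have hs : Set.Icc a b ⊆ Set.Ioi 0 := fun x hx => ha.trans_le hx.1
      refine ⟨(hdc.mono hs).integrableOn_Icc, fun x hx => ?_⟩
      rw [intervalIntegral.integral_deriv_eq_sub]
      · ring
      · intro y hy
        rw [Set.uIcc_of_le hx.1] at hy
        exact hdiff y (ha.trans_le hy.1).ne'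
      · apply ContinuousOn.intervalIntegrable
        rw [Set.uIcc_of_le hx.1]
        exact hdc.mono (fun y hy => ha.trans_le hy.1)
    · refine (hg2.comp Real.tendsto_log_atTop).congr' ?_
      filter_upwards [eventually_gt_atTop 0] with r hr
      rw [hder r hr.ne']
      simp only [Function.comp]
      field_simp
    · intro x hx
      exact hdiff x (ne_of_gt hx.1)
    · exact hdc.mono Set.diff_subset
    · have h1 : ContinuousAt (fun r : ℝ => r ^ ρ₁ r) 1 :=
        continuousAt_id.rpow (hdiff 1 one_ne_zero).continuousAt (Or.inl one_ne_zero)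
      have h2 := h1.tendsto
      rw [Real.one_rpow] at h2
      exact h2.mono_left nhdsWithin_le_nhds
  refine ⟨ρ₁, fun r => Real.exp (Real.log r * (ρ r - ρ₁ r)), hz, ?_, hsymm, ?_,
    fun r _ => Real.exp_pos _, hC1, ?_, ?_⟩
  · intro x hx
    exact (hsm x (ne_of_gt hx.1)).contDiffWithinAt
  · apply Real.continuous_exp.comp_continuousOn
    apply ContinuousOn.mul (Real.continuousOn_log.mono (fun x hx => ne_of_gt hx))
    exact hρc.sub (fun x hx => (hdiff x (ne_of_gt hx)).continuousAt.continuousWithinAt)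
  · refine (hC1.comp tendsto_inv_nhdsGT_zero).congr' ?_
    filter_upwards [self_mem_nhdsWithin] with r hr
    simp only [Function.comp]
    rw [h.symm r hr, hsymm r hr, Real.log_inv]
    congr 1; ring
  · intro r hr
    simp only [V]
    rw [Real.rpow_def_of_pos hr, Real.rpow_def_of_pos hr, ← Real.exp_add]
    congr 1; ring

end
end

section
/- Let ρ be a zero proximate order and set γ(t) = sup_{r>0} V(rt)/V(r). Then γ(t) is finite for every t > 0, γ is continuous on (0,∞), and lim_{t→∞} (log γ(t))/(log t) = 0 as well as lim_{t→∞} (log γ(1/t))/(log t) = 0. -/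
open MeasureTheory Filter Topology Set
open scoped ENNReal

noncomputable section

/-- `γ(t) = sup_{r>0} V(rt)/V(r)` (zero proximate order case). -/
noncomputable def gamma0 (ρ : ℝ → ℝ) (t : ℝ) : ℝ :=
  sSup {y : ℝ | ∃ r : ℝ, 0 < r ∧ y = V ρ (r * t) / V ρ r}

/-- `W(s) = log V(e^s)`. -/
def Wlog (ρ : ℝ → ℝ) (s : ℝ) : ℝ := s * ρ (Real.exp s)

theorem Wlog_even {ρ : ℝ → ℝ} (h : IsZeroProximateOrder ρ) (s : ℝ) :
    Wlog ρ |s| = Wlog ρ s := by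
  rcases abs_choice s with hs | hs
  · rw [hs]
  · rw [hs]
    unfold Wlog
    rw [Real.exp_neg, h.symm _ (Real.exp_pos s)]
    ring

theorem V_eq_exp (ρ : ℝ → ℝ) {r : ℝ} (hr : 0 < r) :
    V ρ r = Real.exp (Wlog ρ (Real.log r)) := by
  unfold V Wlog
  rw [Real.exp_log hr, Real.rpow_def_of_pos hr]

theorem rho_continuousAt {ρ : ℝ → ℝ} (h : IsZeroProximateOrder ρ) {x : ℝ} (hx : 0 < x) :
    ContinuousAt ρ x := by
  have hab : x / 2 ≤ 2 * x := by linarith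
  obtain ⟨hi, he⟩ := h.proximate.locAC (x / 2) (by linarith) (2 * x) hab
  have hc : ContinuousOn ρ (Set.Icc (x / 2) (2 * x)) := by
    have h1 := intervalIntegral.continuousOn_primitive_interval (μ := volume)
      (f := deriv ρ) (a := x / 2) (b := 2 * x) (by rwa [Set.uIcc_of_le hab])
    rw [Set.uIcc_of_le hab] at h1
    exact (continuousOn_const.add h1).congr he
  exact hc.continuousAt (Icc_mem_nhds (by linarith) (by linarith))

theorem Wlog_continuous {ρ : ℝ → ℝ} (h : IsZeroProximateOrder ρ) : Continuous (Wlog ρ) := by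
  rw [continuous_iff_continuousAt]
  intro s
  have h1 : ContinuousAt (fun s => ρ (Real.exp s)) s :=
    ContinuousAt.comp (f := Real.exp) (g := ρ) (rho_continuousAt h (Real.exp_pos s))
      Real.continuous_exp.continuousAt
  exact continuousAt_id.mul h1

theorem Wlog_lip {ρ : ℝ → ℝ} (h : IsZeroProximateOrder ρ) {ε : ℝ} (hε : 0 < ε) :
    ∃ R : ℝ, 0 < R ∧ ∀ x ∈ Set.Ici R, ∀ y ∈ Set.Ici R,
      |Wlog ρ y - Wlog ρ x| ≤ ε * |y - x| := by
  have ht : Tendsto (fun s => ρ (Real.exp s) +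
      Real.exp s * Real.log (Real.exp s) * deriv ρ (Real.exp s)) atTop (nhds (0 + 0)) :=
    (h.proximate.tendsto_lim.comp Real.tendsto_exp_atTop).add
      (h.proximate.tendsto_deriv.comp Real.tendsto_exp_atTop)
  rw [add_zero] at ht
  have h2 := (Metric.tendsto_nhds.1 ht ε hε)
  obtain ⟨R0, hR0⟩ := eventually_atTop.1 h2
  refine ⟨max R0 1, by positivity, ?_⟩
  intro x hx y hy
  refine (convex_Ici (max R0 1)).norm_image_sub_le_of_norm_hasDerivWithin_le
    (f := Wlog ρ) (f' := fun s => ρ (Real.exp s) +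
      Real.exp s * Real.log (Real.exp s) * deriv ρ (Real.exp s)) ?_ ?_ hx hy
  · intro s hs
    have hs1 : 1 ≤ s := le_trans (le_max_right _ _) hs
    have hd : DifferentiableAt ℝ ρ (Real.exp s) := by
      refine h.diffAway _ ⟨Real.exp_pos s, ?_⟩
      simp only [Set.mem_singleton_iff, Real.exp_eq_one_iff]
      linarith
    have h3 := (hasDerivAt_id s).mul (hd.hasDerivAt.comp s (Real.hasDerivAt_exp s))
    refine HasDerivAt.hasDerivWithinAt ?_
    have h4 : HasDerivAt (Wlog ρ)
        (1 * (ρ ∘ Real.exp) s + id s * (deriv ρ (Real.exp s) * Real.exp s)) s := h3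
    refine h4.congr_deriv ?_
    rw [Real.log_exp]
    simp only [id, Function.comp]
    ring
  · intro s hs
    have := hR0 s (le_trans (le_max_left _ _) hs)
    rw [dist_zero_right] at this
    exact this.le

theorem Wlog_bound {ρ : ℝ → ℝ} (h : IsZeroProximateOrder ρ) {ε : ℝ} (hε : 0 < ε) :
    ∃ C : ℝ, 0 ≤ C ∧ ∀ x y : ℝ, |Wlog ρ y - Wlog ρ x| ≤ ε * |y - x| + C := by
  obtain ⟨R, hR, hL⟩ := Wlog_lip h hε
  obtain ⟨M, hM⟩ := (isCompact_Icc (a := (0:ℝ)) (b := R)).exists_bound_of_continuousOn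
    (Wlog_continuous h).continuousOn
  have hM0 : 0 ≤ M := le_trans (norm_nonneg _) (hM 0 ⟨le_rfl, hR.le⟩)
  have key : ∀ x, 0 ≤ x → |Wlog ρ x - Wlog ρ (max x R)| ≤ 2 * M := by
    intro x hx
    rcases le_total x R with hxR | hxR
    · rw [max_eq_right hxR]
      have h1 := hM x ⟨hx, hxR⟩
      have h2 := hM R ⟨hR.le, le_rfl⟩
      rw [Real.norm_eq_abs] at h1 h2
      have := abs_sub (Wlog ρ x) (Wlog ρ R)
      linarith
    · rw [max_eq_left hxR]; simpa using hM0
  refine ⟨4 * M, by positivity, fun x y => ?_⟩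
  rw [← Wlog_even h x, ← Wlog_even h y]
  have h1 := key |x| (abs_nonneg x)
  have h2 := key |y| (abs_nonneg y)
  have h3 := hL (max |x| R) (Set.mem_Ici.2 (le_max_right _ _)) (max |y| R) (Set.mem_Ici.2 (le_max_right _ _))
  have h4 : |max |y| R - max |x| R| ≤ |y - x| :=
    (abs_max_sub_max_le_abs _ _ _).trans (abs_abs_sub_abs_le _ _)
  have h5 := mul_le_mul_of_nonneg_left h4 hε.le
  rw [abs_le] at h1 h2 h3 ⊢
  constructor <;> linarith [h1.1, h1.2, h2.1, h2.2, h3.1, h3.2]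

theorem Wlog_uc {ρ : ℝ → ℝ} (h : IsZeroProximateOrder ρ) : UniformContinuous (Wlog ρ) := by
  obtain ⟨R, hR, hL⟩ := Wlog_lip h one_pos
  have hf : UniformContinuous (fun x : ℝ => Wlog ρ (max |x| R)) := by
    refine (LipschitzWith.of_dist_le_mul (K := 1) ?_).uniformContinuous
    intro x y
    rw [Real.dist_eq, Real.dist_eq]
    have h3 := hL (max |y| R) (Set.mem_Ici.2 (le_max_right _ _)) (max |x| R) (Set.mem_Ici.2 (le_max_right _ _))
    have h4 : |max |x| R - max |y| R| ≤ |x - y| :=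
      (abs_max_sub_max_le_abs _ _ _).trans (abs_abs_sub_abs_le _ _)
    simpa using h3.trans (by simpa using h4)
  have hg : UniformContinuous (fun x : ℝ => Wlog ρ (Set.projIcc 0 R hR.le |x|)) := by
    have h1 : UniformContinuous (fun z : Set.Icc (0:ℝ) R => Wlog ρ z) :=
      CompactSpace.uniformContinuous_of_continuous
        ((Wlog_continuous h).comp continuous_subtype_val)
    have h2 : UniformContinuous (fun x : ℝ => Set.projIcc 0 R hR.le |x|) :=
      (LipschitzWith.projIcc hR.le).uniformContinuous.comp
        (lipschitzWith_one_norm (E := ℝ)).uniformContinuous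
    exact h1.comp h2
  have : Wlog ρ = fun x : ℝ => Wlog ρ (max |x| R) + Wlog ρ (Set.projIcc 0 R hR.le |x|)
      - Wlog ρ R := by
    funext x
    rw [← Wlog_even h x]
    rcases le_total |x| R with hx | hx
    · rw [max_eq_right hx, Set.projIcc_of_mem hR.le ⟨abs_nonneg x, hx⟩]; ring
    · rw [max_eq_left hx, Set.projIcc_of_right_le hR.le hx]; ring
  rw [this]
  exact (hf.add hg).sub uniformContinuous_const

/-- `G(τ) = log γ(e^τ)`. -/
def Glog (ρ : ℝ → ℝ) (τ : ℝ) : ℝ := ⨆ s : ℝ, (Wlog ρ (s + τ) - Wlog ρ s)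

theorem Glog_bdd {ρ : ℝ → ℝ} (h : IsZeroProximateOrder ρ) (τ : ℝ) :
    BddAbove (Set.range fun s : ℝ => (Wlog ρ (s + τ) - Wlog ρ s)) := by
  obtain ⟨C, -, hC⟩ := Wlog_bound h one_pos
  refine ⟨1 * |τ| + C, ?_⟩
  rintro _ ⟨s, rfl⟩
  have := hC s (s + τ)
  rw [add_sub_cancel_left] at this
  exact (le_abs_self _).trans this

theorem Glog_bound {ρ : ℝ → ℝ} (h : IsZeroProximateOrder ρ) {ε : ℝ} (hε : 0 < ε) :
    ∃ C : ℝ, 0 ≤ C ∧ ∀ τ : ℝ, |Glog ρ τ| ≤ ε * |τ| + C := by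
  obtain ⟨C, hC0, hC⟩ := Wlog_bound h hε
  refine ⟨C, hC0, fun τ => ?_⟩
  have h1 : ∀ s, |Wlog ρ (s + τ) - Wlog ρ s| ≤ ε * |τ| + C := fun s => by
    have := hC s (s + τ)
    rwa [add_sub_cancel_left] at this
  rw [abs_le]
  constructor
  · exact (abs_le.1 (h1 0)).1.trans (le_ciSup (Glog_bdd h τ) 0)
  · exact ciSup_le fun s => (abs_le.1 (h1 s)).2

theorem Glog_continuous {ρ : ℝ → ℝ} (h : IsZeroProximateOrder ρ) : Continuous (Glog ρ) := by
  rw [Metric.continuous_iff]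
  intro b ε hε
  obtain ⟨δ, hδ, H⟩ := Metric.uniformContinuous_iff.1 (Wlog_uc h) (ε / 2) (half_pos hε)
  refine ⟨δ, hδ, fun a hab => ?_⟩
  have key : ∀ p q : ℝ, dist p q < δ → Glog ρ p ≤ Glog ρ q + ε / 2 := by
    intro p q hpq
    refine ciSup_le fun s => ?_
    have h1 := le_ciSup (Glog_bdd h q) s
    have h2 := H (a := s + p) (b := s + q) (by simpa using hpq)
    rw [Real.dist_eq, abs_lt] at h2
    unfold Glog
    linarith [h2.2]
  have h1 := key a b hab
  have h2 := key b a (by rwa [dist_comm])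
  rw [Real.dist_eq, abs_lt]
  constructor <;> linarith

theorem set_eq (ρ : ℝ → ℝ) {t : ℝ} (ht : 0 < t) :
    {y : ℝ | ∃ r : ℝ, 0 < r ∧ y = V ρ (r * t) / V ρ r} =
      Set.range fun s : ℝ => Real.exp (Wlog ρ (s + Real.log t) - Wlog ρ s) := by
  ext y
  constructor
  · rintro ⟨r, hr, rfl⟩
    refine ⟨Real.log r, ?_⟩
    simp only
    rw [V_eq_exp ρ hr, V_eq_exp ρ (mul_pos hr ht), Real.log_mul hr.ne' ht.ne', Real.exp_sub]
  · rintro ⟨s, rfl⟩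
    refine ⟨Real.exp s, Real.exp_pos s, ?_⟩
    beta_reduce
    rw [V_eq_exp ρ (Real.exp_pos s), V_eq_exp ρ (mul_pos (Real.exp_pos s) ht),
      Real.log_mul (Real.exp_pos s).ne' ht.ne', Real.log_exp, Real.exp_sub]

theorem gamma0_eq {ρ : ℝ → ℝ} (h : IsZeroProximateOrder ρ) {t : ℝ} (ht : 0 < t) :
    gamma0 ρ t = Real.exp (Glog ρ (Real.log t)) := by
  unfold gamma0 Glog
  rw [set_eq ρ ht, Real.exp_monotone.map_ciSup_of_continuousAt
    Real.continuous_exp.continuousAt (Glog_bdd h _)]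
  rfl

theorem Glog_tendsto {ρ : ℝ → ℝ} (h : IsZeroProximateOrder ρ) (g : ℝ → ℝ)
    (hg : ∀ τ, |g τ| = |τ|) : Tendsto (fun τ => Glog ρ (g τ) / τ) atTop (nhds 0) := by
  rw [Metric.tendsto_nhds]
  intro ε hε
  obtain ⟨C, hC0, hC⟩ := Glog_bound h (half_pos hε)
  filter_upwards [eventually_gt_atTop (2 * C / ε), eventually_gt_atTop 0] with τ h1 h2
  rw [dist_zero_right, Real.norm_eq_abs, abs_div, abs_of_pos h2, div_lt_iff₀ h2]
  have h3 := hC (g τ)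
  rw [hg, abs_of_pos h2] at h3
  rw [div_lt_iff₀ hε] at h1
  nlinarith

/-- Theorem 2.5: for a zero proximate order `ρ`,
`γ(t) = sup_{r>0} V(rt)/V(r)` is finite for every `t > 0`, is continuous on
`(0,∞)`, and `log γ(t)/log t → 0` and `log γ(1/t)/log t → 0` as `t → ∞`. -/
theorem statement1 (ρ : ℝ → ℝ) (h : IsZeroProximateOrder ρ) :
    (∀ t : ℝ, 0 < t → BddAbove {y : ℝ | ∃ r : ℝ, 0 < r ∧ y = V ρ (r * t) / V ρ r}) ∧
    ContinuousOn (gamma0 ρ) (Set.Ioi (0:ℝ)) ∧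
    Filter.Tendsto (fun t => Real.log (gamma0 ρ t) / Real.log t) Filter.atTop (nhds 0) ∧
    Filter.Tendsto (fun t => Real.log (gamma0 ρ t⁻¹) / Real.log t) Filter.atTop (nhds 0) := by
  refine ⟨fun t ht => ?_, ?_, ?_, ?_⟩
  · rw [set_eq ρ ht]
    obtain ⟨B, hB⟩ := Glog_bdd h (Real.log t)
    refine ⟨Real.exp B, ?_⟩
    rintro _ ⟨s, rfl⟩
    exact Real.exp_le_exp.2 (hB ⟨s, rfl⟩)
  · have h1 : ContinuousOn (fun t => Real.exp (Glog ρ (Real.log t))) (Set.Ioi (0:ℝ)) :=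
      (Real.continuous_exp.comp (Glog_continuous h)).comp_continuousOn
        (Real.continuousOn_log.mono fun x hx => ne_of_gt hx)
    exact h1.congr fun t ht => gamma0_eq h ht
  · refine ((Glog_tendsto h id fun _ => rfl).comp Real.tendsto_log_atTop).congr' ?_
    filter_upwards [eventually_gt_atTop 0] with t ht
    rw [gamma0_eq h ht, Real.log_exp]
    rfl
  · refine ((Glog_tendsto h (fun τ => -τ) abs_neg).comp Real.tendsto_log_atTop).congr' ?_
    filter_upwards [eventually_gt_atTop 0] with t ht
    rw [gamma0_eq h (inv_pos.2 ht), Real.log_exp, Real.log_inv]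
    rfl

end
end
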